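/- Let α, β ∈ ℂ with α·β ≠ 0, set A = α³ and B = β², and fix γ ∈ ℂ with γ² = β³/α³. Then for all t, x, y ∈ ℂ one has the identity ((β/α)·x)³ − 3·α·(β·t)⁴·((β/α)·x) + (β·t)⁵·((β·t)² − 2·β·(β·t) + 1) − (γ·y)² = (β³/α³)·(x³ − 3·A·B·t⁴·x + A·B·t⁵·(B·t² − 2·B·t + 1) − y²). In particular, the change of variables t ↦ β·t, x ↦ (β/α)·x, y ↦ γ·y transforms the Weierstrass equation y² = x³ − 3·α·t⁴·x + t⁵·(t² − 2·β·t + 1) into the Weierstrass equation y² = x³ − 3·A·B·t⁴·x + A·B·t⁵·(B·t² − 2·B·t + 1), whose coefficients lie in the field ℚ(A, B). -/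

import Mathlib

/-- The twisting computation for Inose's pencil: the change of variables
`t ↦ β·t, x ↦ (β/α)·x, y ↦ γ·y` (with `γ² = β³/α³`) transforms the Weierstrass
equation `y² = x³ − 3·α·t⁴·x + t⁵·(t² − 2·β·t + 1)` into
`y² = x³ − 3·A·B·t⁴·x + A·B·t⁵·(B·t² − 2·B·t + 1)` where `A = α³`, `B = β²`. -/
theorem inose_pencil_twist (α β γ A B : ℂ) (hαβ : α * β ≠ 0)
    (hA : A = α ^ 3) (hB : B = β ^ 2) (hγ : γ ^ 2 = β ^ 3 / α ^ 3) :
    (∀ t x y : ℂ,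
      ((β / α) * x) ^ 3 - 3 * α * (β * t) ^ 4 * ((β / α) * x)
        + (β * t) ^ 5 * ((β * t) ^ 2 - 2 * β * (β * t) + 1) - (γ * y) ^ 2
      = (β ^ 3 / α ^ 3) *
          (x ^ 3 - 3 * A * B * t ^ 4 * x
            + A * B * t ^ 5 * (B * t ^ 2 - 2 * B * t + 1) - y ^ 2)) ∧
    (∀ t x y : ℂ,
      (γ * y) ^ 2
          = ((β / α) * x) ^ 3 - 3 * α * (β * t) ^ 4 * ((β / α) * x)
            + (β * t) ^ 5 * ((β * t) ^ 2 - 2 * β * (β * t) + 1)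
        ↔ y ^ 2 = x ^ 3 - 3 * A * B * t ^ 4 * x
            + A * B * t ^ 5 * (B * t ^ 2 - 2 * B * t + 1)) := by
  have hα : α ≠ 0 := left_ne_zero_of_mul hαβ
  have hβ : β ≠ 0 := right_ne_zero_of_mul hαβ
  have hc : β ^ 3 / α ^ 3 ≠ 0 := div_ne_zero (pow_ne_zero 3 hβ) (pow_ne_zero 3 hα)
  have key : ∀ t x y : ℂ,
      ((β / α) * x) ^ 3 - 3 * α * (β * t) ^ 4 * ((β / α) * x)
        + (β * t) ^ 5 * ((β * t) ^ 2 - 2 * β * (β * t) + 1) - (γ * y) ^ 2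
      = (β ^ 3 / α ^ 3) *
          (x ^ 3 - 3 * A * B * t ^ 4 * x
            + A * B * t ^ 5 * (B * t ^ 2 - 2 * B * t + 1) - y ^ 2) := by
    intro t x y
    rw [mul_pow γ y, hγ, hA, hB]
    field_simp
  refine ⟨key, fun t x y => ?_⟩
  rw [eq_comm, ← sub_eq_zero, key, mul_eq_zero, or_iff_right hc, sub_eq_zero, eq_comm]
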